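/- arXiv:1003.4874 — 3 statements merged into one kernel-verified Lean document; each statement's English description precedes it below -/
import Mathlib

section
/- Let X be a connected scheme of finite type over k. Then for every m ∈ ℕ the jet scheme X_m is connected. -/
open AlgebraicGeometry CategoryTheory CategoryTheory.Limits

universe u

noncomputable section

variable (k : Type u) [Field k] (m : ℕ)

/-- The base scheme `S = Spec k`. -/
abbrev Sk : Scheme.{u} := Spec (CommRingCat.of k)

/-- The ring `k[t]/(t^{m+1})`. -/
abbrev Dring : Type u := Polynomial k ⧸ Ideal.span {(Polynomial.X : Polynomial k) ^ (m + 1)}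

/-- `Spec k[t]/(t^{m+1})` as a scheme over `Spec k`. -/
abbrev Dm : Over (Sk k) := Over.mk (Spec.map (CommRingCat.ofHom (algebraMap k (Dring k m))))

/-- Evaluation at `t = 0` as a ring map `k[t]/(t^{m+1}) → k`. -/
def ev0 : Dring k m →+* k :=
  Ideal.Quotient.lift _ (Polynomial.evalRingHom (0 : k)) (by
    intro a ha
    rw [Ideal.mem_span_singleton] at ha
    obtain ⟨c, rfl⟩ := ha
    simp [zero_pow])

lemma ev0_section :
    (CommRingCat.ofHom (algebraMap k (Dring k m))) ≫ (CommRingCat.ofHom (ev0 k m)) =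
      𝟙 (CommRingCat.of k) := by
  ext c
  have h : algebraMap k (Dring k m) c =
      Ideal.Quotient.mk (Ideal.span {(Polynomial.X : Polynomial k) ^ (m + 1)})
        (Polynomial.C c) := rfl
  show ev0 k m (algebraMap k (Dring k m) c) = c
  rw [h]
  simp [ev0]

/-- The zero section `Spec k → Spec k[t]/(t^{m+1})` over `Spec k`. -/
def zeroSec : Over.mk (𝟙 (Sk k)) ⟶ Dm k m :=
  Over.homMk (Spec.map (CommRingCat.ofHom (ev0 k m))) (by
    simpa using congrArg Spec.map (ev0_section k m))

/-- The canonical morphism `Z → Dm` over `Spec k`, via the terminal object. -/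
def toD (Z : Over (Sk k)) : Z ⟶ Dm k m :=
  Over.mkIdTerminal.from Z ≫ zeroSec k m

section Rescaling

/-- Pullback of global functions along a morphism of `k`-schemes. -/
abbrev pullbackFun {Z Z' : Over (Sk k)} (f : Z' ⟶ Z) : Γ(Z.left, ⊤) →+* Γ(Z'.left, ⊤) :=
  f.left.appTop.hom

/-- The structure map `k → Γ(W)` of a `k`-scheme `W`. -/
def structureRingHom (W : Over (Sk k)) : k →+* Γ(W.left, ⊤) :=
  ((Scheme.ΓSpecIso (CommRingCat.of k)).inv ≫ W.hom.appTop).hom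

/-- The comorphism `k[t]/(t^{m+1}) → Γ(W)` of a morphism `W ⟶ Dm`. -/
def comorphism {W : Over (Sk k)} (f : W ⟶ Dm k m) : Dring k m →+* Γ(W.left, ⊤) :=
  ((Scheme.ΓSpecIso (CommRingCat.of (Dring k m))).inv ≫ f.left.appTop).hom

/-- The class of `t` in `k[t]/(t^{m+1})`. -/
def tclass : Dring k m := Ideal.Quotient.mk _ Polynomial.X

lemma tclass_pow : tclass k m ^ (m + 1) = 0 := by
  rw [tclass, ← map_pow, Ideal.Quotient.eq_zero_iff_mem]
  exact Ideal.mem_span_singleton_self _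

variable {k m}

lemma comorphism_comp {W W' : Over (Sk k)} (g : W' ⟶ W) (f : W ⟶ Dm k m) (d : Dring k m) :
    comorphism k m (g ≫ f) d = pullbackFun k g (comorphism k m f d) := by
  rw [comorphism, Over.comp_left, Scheme.Hom.comp_appTop]
  rfl

lemma comorphism_algebraMap {W : Over (Sk k)} (f : W ⟶ Dm k m) :
    (comorphism k m f).comp (algebraMap k (Dring k m)) = structureRingHom k W := by
  have h := Over.w f
  simp only [Over.mk_hom] at h
  rw [structureRingHom, ← h, Scheme.Hom.comp_appTop, ← Scheme.ΓSpecIso_inv_naturality_assoc]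
  rfl

lemma comorphism_injective {W : Over (Sk k)} {f g : W ⟶ Dm k m}
    (h : comorphism k m f = comorphism k m g) : f = g := by
  apply Over.OverMorphism.ext
  have : IsAffine (Dm k m).left := inferInstanceAs (IsAffine (Spec _))
  apply ext_of_isAffine
  rw [← cancel_epi (Scheme.ΓSpecIso (CommRingCat.of (Dring k m))).inv]
  exact CommRingCat.hom_ext h

/-- Morphisms to `Spec k[t]/(t^{m+1})` are determined by the pullback of `t`. -/
lemma hom_Dm_ext {W : Over (Sk k)} {f g : W ⟶ Dm k m}
    (h : comorphism k m f (tclass k m) = comorphism k m g (tclass k m)) : f = g := by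
  apply comorphism_injective
  apply Ideal.Quotient.ringHom_ext
  apply Polynomial.ringHom_ext
  · intro c
    exact (RingHom.congr_fun (comorphism_algebraMap f) c).trans
      (RingHom.congr_fun (comorphism_algebraMap g) c).symm
  · exact h

/-- The ring map `k[t]/(t^{m+1}) → Γ(W)` sending `t` to `a`. -/
def ringHomOfPowEqZero (W : Over (Sk k)) (a : Γ(W.left, ⊤)) (ha : a ^ (m + 1) = 0) :
    Dring k m →+* Γ(W.left, ⊤) :=
  Ideal.Quotient.lift _ (Polynomial.eval₂RingHom (structureRingHom k W) a) (by
    intro p hp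
    obtain ⟨c, rfl⟩ := Ideal.mem_span_singleton.mp hp
    simp [ha])

lemma ringHomOfPowEqZero_comp_algebraMap (W : Over (Sk k)) (a : Γ(W.left, ⊤))
    (ha : a ^ (m + 1) = 0) :
    (ringHomOfPowEqZero W a ha).comp (algebraMap k (Dring k m)) = structureRingHom k W := by
  ext c
  exact Polynomial.eval₂_C _ _

/-- The morphism `W ⟶ Spec k[t]/(t^{m+1})` given by a function `a` with `a ^ (m + 1) = 0`. -/
def homOfPowEqZero (W : Over (Sk k)) (a : Γ(W.left, ⊤)) (ha : a ^ (m + 1) = 0) : W ⟶ Dm k m :=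
  Over.homMk (W.left.toSpecΓ ≫ Spec.map (CommRingCat.ofHom (ringHomOfPowEqZero W a ha))) (by
    have h : CommRingCat.ofHom (algebraMap k (Dring k m)) ≫
        CommRingCat.ofHom (ringHomOfPowEqZero W a ha) =
        (Scheme.ΓSpecIso (CommRingCat.of k)).inv ≫ W.hom.appTop :=
      CommRingCat.hom_ext (ringHomOfPowEqZero_comp_algebraMap W a ha)
    change (_ ≫ Spec.map _) ≫ Spec.map _ = _
    rw [Category.assoc, ← Spec.map_comp, h, Spec.map_comp,
      ← Scheme.toSpecΓ_naturality_assoc, toSpecΓ_SpecMap_ΓSpecIso_inv, Category.comp_id])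

lemma comorphism_homOfPowEqZero (W : Over (Sk k)) (a : Γ(W.left, ⊤)) (ha : a ^ (m + 1) = 0) :
    comorphism k m (homOfPowEqZero W a ha) (tclass k m) = a := by
  have h : (Scheme.ΓSpecIso (CommRingCat.of (Dring k m))).inv ≫
      (homOfPowEqZero W a ha).left.appTop = CommRingCat.ofHom (ringHomOfPowEqZero W a ha) := by
    change _ ≫ (W.left.toSpecΓ ≫ Spec.map _).appTop = _
    rw [Scheme.Hom.comp_appTop, Scheme.toSpecΓ_appTop,
      ← Scheme.ΓSpecIso_inv_naturality_assoc, Iso.inv_hom_id, Category.comp_id]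
  rw [comorphism, h]
  exact Polynomial.eval₂_X _ _

lemma comorphism_toD (W : Over (Sk k)) : comorphism k m (toD k m W) (tclass k m) = 0 := by
  have h : comorphism k m (zeroSec k m) (tclass k m) = 0 := by
    have e : (Scheme.ΓSpecIso (CommRingCat.of (Dring k m))).inv ≫ (zeroSec k m).left.appTop =
        CommRingCat.ofHom (ev0 k m) ≫ (Scheme.ΓSpecIso (CommRingCat.of k)).inv := by
      rw [Scheme.ΓSpecIso_inv_naturality]
      rfl
    have e0 : ev0 k m (tclass k m) = 0 := by simp [ev0, tclass]
    rw [comorphism, e, CommRingCat.hom_comp, RingHom.comp_apply, CommRingCat.hom_ofHom, e0,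
      map_zero]
  rw [toD, comorphism_comp, h, map_zero]

/-- The morphism `Z × Dm ⟶ Dm`, `(z, t) ↦ a(z) t`. -/
def scale {Z : Over (Sk k)} (a : Γ(Z.left, ⊤)) : (Z ⨯ Dm k m) ⟶ Dm k m :=
  homOfPowEqZero _ (pullbackFun k prod.fst a * comorphism k m prod.snd (tclass k m)) (by
    rw [mul_pow, ← map_pow (comorphism k m prod.snd), tclass_pow, map_zero, mul_zero])

lemma comorphism_scale {Z : Over (Sk k)} (a : Γ(Z.left, ⊤)) :
    comorphism k m (scale a) (tclass k m) =
      pullbackFun k prod.fst a * comorphism k m prod.snd (tclass k m) :=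
  comorphism_homOfPowEqZero _ _ _

lemma pullbackFun_comp {Z Z' Z'' : Over (Sk k)} (g : Z'' ⟶ Z') (f : Z' ⟶ Z) (a : Γ(Z.left, ⊤)) :
    pullbackFun k (g ≫ f) a = pullbackFun k g (pullbackFun k f a) := by
  rw [pullbackFun, Over.comp_left, Scheme.Hom.comp_appTop]
  rfl

lemma map_comp_scale {Z Z' : Over (Sk k)} (g : Z' ⟶ Z) (a : Γ(Z.left, ⊤)) :
    prod.map g (𝟙 (Dm k m)) ≫ scale a = scale (pullbackFun k g a) := by
  apply hom_Dm_ext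
  rw [comorphism_comp, comorphism_scale, comorphism_scale, map_mul, ← pullbackFun_comp,
    ← comorphism_comp, ← pullbackFun_comp, prod.map_fst, prod.map_snd, Category.comp_id]

lemma scale_one (Z : Over (Sk k)) : scale (m := m) (1 : Γ(Z.left, ⊤)) = prod.snd := by
  apply hom_Dm_ext
  rw [comorphism_scale, map_one, one_mul]

lemma scale_zero (Z : Over (Sk k)) : scale (m := m) (0 : Γ(Z.left, ⊤)) = toD k m _ := by
  apply hom_Dm_ext
  rw [comorphism_scale, map_zero, zero_mul, comorphism_toD]

lemma comp_toD {Z Z' : Over (Sk k)} (g : Z' ⟶ Z) : g ≫ toD k m Z = toD k m Z' := by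
  apply hom_Dm_ext
  rw [comorphism_comp, comorphism_toD, comorphism_toD, map_zero]

section Jets

variable {X Xm : Over (Sk k)} (J : ∀ Z : Over (Sk k), (Z ⟶ Xm) ≃ ((Z ⨯ Dm k m) ⟶ X))

/-- The jet family `f` over `Z` rescaled by the function `a` in the parameter `t`. -/
def rescale {Z : Over (Sk k)} (a : Γ(Z.left, ⊤)) (f : Z ⟶ Xm) : Z ⟶ Xm :=
  (J Z).symm (prod.lift prod.fst (scale a) ≫ J Z f)

/-- The section `X ⟶ Xm` given by constant jets. -/
def constJet : X ⟶ Xm := (J X).symm prod.fst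

lemma rescale_one {Z : Over (Sk k)} (f : Z ⟶ Xm) : rescale J 1 f = f := by
  rw [rescale, scale_one, prod.lift_fst_snd, Category.id_comp, Equiv.symm_apply_apply]

lemma comp_rescale
    (Jnat : ∀ {Z Z' : Over (Sk k)} (g : Z' ⟶ Z) (f : Z ⟶ Xm),
      J Z' (g ≫ f) = prod.map g (𝟙 (Dm k m)) ≫ J Z f)
    {Z Z' : Over (Sk k)} (g : Z' ⟶ Z) (a : Γ(Z.left, ⊤)) (f : Z ⟶ Xm) :
    g ≫ rescale J a f = rescale J (pullbackFun k g a) (g ≫ f) := by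
  apply (J Z').injective
  rw [Jnat, rescale, rescale, Equiv.apply_symm_apply, Equiv.apply_symm_apply, Jnat,
    ← Category.assoc, ← Category.assoc]
  congr 1
  ext1 <;> simp [← map_comp_scale]

lemma rescale_zero
    (Jnat : ∀ {Z Z' : Over (Sk k)} (g : Z' ⟶ Z) (f : Z ⟶ Xm),
      J Z' (g ≫ f) = prod.map g (𝟙 (Dm k m)) ≫ J Z f)
    {Z : Over (Sk k)} (f : Z ⟶ Xm) :
    rescale J 0 f = (prod.lift (𝟙 Z) (toD k m Z) ≫ J Z f) ≫ constJet J := by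
  apply (J Z).injective
  rw [Jnat, rescale, constJet, Equiv.apply_symm_apply, Equiv.apply_symm_apply, prod.map_fst,
    ← Category.assoc]
  congr 1
  ext1 <;> simp [scale_zero, comp_toD]

/-- Every `K`-valued point of `Xm` is joined to the constant jets by an affine line over `K`. -/
lemma exists_preconnected_mem_of_hom
    (Jnat : ∀ {Z Z' : Over (Sk k)} (g : Z' ⟶ Z) (f : Z ⟶ Xm),
      J Z' (g ≫ f) = prod.map g (𝟙 (Dm k m)) ≫ J Z f)
    {K : CommRingCat.{u}} (hK : IsDomain K)
    (φ : Spec K ⟶ Xm.left) (pt : Spec K) :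
    ∃ (s : Set Xm.left) (x : X.left),
      _root_.IsPreconnected s ∧ φ pt ∈ s ∧ (constJet J).left x ∈ s := by
  let ι : K ⟶ CommRingCat.of (Polynomial K) := CommRingCat.ofHom Polynomial.C
  let ev (c : K) : CommRingCat.of (Polynomial K) ⟶ K :=
    CommRingCat.ofHom (Polynomial.evalRingHom c)
  have hev (c : K) : ι ≫ ev c = 𝟙 _ := by
    ext
    simp [ι, ev]
  have hspec (c : K) : Spec.map (ev c) ≫ Spec.map ι = 𝟙 _ := by
    rw [← Spec.map_comp, hev, Spec.map_id]
  let S : Over (Sk k) := Over.mk (φ ≫ Xm.hom)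
  let p : S ⟶ Xm := Over.homMk φ
  let Z : Over (Sk k) := Over.mk (Spec.map ι ≫ φ ≫ Xm.hom)
  let q : Z ⟶ S := Over.homMk (Spec.map ι)
  let e (c : K) : S ⟶ Z := Over.homMk (Spec.map (ev c)) (by
    change Spec.map (ev c) ≫ Spec.map ι ≫ φ ≫ Xm.hom = φ ≫ Xm.hom
    rw [← Category.assoc, hspec, Category.id_comp])
  have heq (c : K) : e c ≫ q = 𝟙 S := Over.OverMorphism.ext (hspec c)
  let a : Γ(Z.left, ⊤) :=
    (Scheme.ΓSpecIso (CommRingCat.of (Polynomial K))).inv.hom (Polynomial.X : Polynomial K)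
  let incl : K →+* Γ(S.left, ⊤) := (Scheme.ΓSpecIso K).inv.hom
  have hea (c : K) : pullbackFun k (e c) a = incl c := by
    have h := RingHom.congr_fun (congrArg CommRingCat.Hom.hom
      (Scheme.ΓSpecIso_inv_naturality (ev c))) (Polynomial.X : Polynomial K)
    refine h.symm.trans ?_
    change incl (Polynomial.eval c Polynomial.X) = incl c
    rw [Polynomial.eval_X]
  let F : Z ⟶ Xm := rescale J a (q ≫ p)
  have hF (c : K) : e c ≫ F = rescale J (incl c) p := by
    rw [comp_rescale J Jnat, hea, ← Category.assoc, heq, Category.id_comp]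
  have h1 : e 1 ≫ F = p := by
    rw [hF, map_one, rescale_one]
  have h0 : e 0 ≫ F = (prod.lift (𝟙 S) (toD k m S) ≫ J S p) ≫ constJet J := by
    rw [hF, map_zero, rescale_zero J Jnat]
  have : IrreducibleSpace Z.left :=
    inferInstanceAs (IrreducibleSpace (PrimeSpectrum (Polynomial K)))
  refine ⟨Set.range F.left, (prod.lift (𝟙 S) (toD k m S) ≫ J S p).left pt,
    isPreconnected_range F.left.continuous, ⟨(e 1).left pt, ?_⟩, ⟨(e 0).left pt, ?_⟩⟩
  · rw [← Scheme.Hom.comp_apply, ← Over.comp_left, h1]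
    rfl
  · rw [← Scheme.Hom.comp_apply, ← Over.comp_left, h0, Over.comp_left, Scheme.Hom.comp_apply]

lemma exists_preconnected_mem
    (Jnat : ∀ {Z Z' : Over (Sk k)} (g : Z' ⟶ Z) (f : Z ⟶ Xm),
      J Z' (g ≫ f) = prod.map g (𝟙 (Dm k m)) ≫ J Z f)
    (P : Xm.left) :
    ∃ (s : Set Xm.left) (x : X.left),
      _root_.IsPreconnected s ∧ P ∈ s ∧ (constJet J).left x ∈ s := by
  have h := exists_preconnected_mem_of_hom J Jnat (K := Xm.left.residueField P)
    (Field.toIsField (Xm.left.residueField P)).isDomain (Xm.left.fromSpecResidueField P)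
    (default : PrimeSpectrum (Xm.left.residueField P))
  have hP := Scheme.fromSpecResidueField_apply P
    (default : PrimeSpectrum (Xm.left.residueField P))
  obtain ⟨s, x, hs, hmem, hx⟩ := h
  exact ⟨s, x, hs, hP ▸ hmem, hx⟩

end Jets

end Rescaling

/-- Let `X` be a connected scheme of finite type over `k`.  Then for every
`m ∈ ℕ` the `m`-jet scheme `X_m` (representing `Z ↦ Hom_k(Z ×_k Spec k[t]/(t^{m+1}), X)`)
is connected. -/
theorem stmt8
    (X Xm : Over (Sk k))
    [LocallyOfFiniteType X.hom] [QuasiCompact X.hom]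
    (J : ∀ Z : Over (Sk k), (Z ⟶ Xm) ≃ ((Z ⨯ Dm k m) ⟶ X))
    (Jnat : ∀ {Z Z' : Over (Sk k)} (g : Z' ⟶ Z) (f : Z ⟶ Xm),
      J Z' (g ≫ f) = prod.map g (𝟙 (Dm k m)) ≫ J Z f)
    (hconn : ConnectedSpace X.left) :
    ConnectedSpace Xm.left := by
  obtain ⟨x₀⟩ := hconn.toNonempty
  rw [connectedSpace_iff_univ]
  have hr : _root_.IsPreconnected (Set.range (constJet J).left) :=
    isPreconnected_range (constJet J).left.continuous
  refine ⟨⟨(constJet J).left x₀, trivial⟩,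
    isPreconnected_of_forall ((constJet J).left x₀) fun P _ => ?_⟩
  obtain ⟨s, x, hs, hP, hx⟩ := exists_preconnected_mem J Jnat P
  exact ⟨s ∪ Set.range (constJet J).left, Set.subset_univ _, Or.inr ⟨x₀, rfl⟩, Or.inl hP,
    hs.union _ hx ⟨x, rfl⟩ hr⟩

end
end

section
/- Let X ⊂ 𝔸³ over ℂ be the curve defined by x³ − y² = 0 and x² − z³ = 0. For every m ≥ 1, the fiber π_m^{-1}(0) of the m-jet scheme over the origin has dimension ≥ m + 2, while the closure of π_m^{-1}(X_reg) has dimension m + 1; hence X_m is reducible for every m ≥ 1. -/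
open MvPolynomial

section Dimension

/-- The zero locus of the kernel of a surjection `f : A → B` has the Krull dimension of `B`. -/
lemma topologicalKrullDim_zeroLocus_ker {A B : Type*} [CommRing A] [CommRing B] (f : A →+* B)
    (hf : Function.Surjective f) :
    topologicalKrullDim (PrimeSpectrum.zeroLocus (RingHom.ker f : Set A)) = ringKrullDim B := by
  rw [← PrimeSpectrum.topologicalKrullDim_eq_ringKrullDim,
    ← range_comap_of_surjective B f hf]
  have h := (PrimeSpectrum.isClosedEmbedding_comap_of_surjective B f hf).isEmbedding
  exact (IsHomeomorph.topologicalKrullDim_eq _ h.toHomeomorph.isHomeomorph).symm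

/-- If `f : A → B` is surjective and kills `s`, the zero locus of `s` has dimension at least that
of `B`. -/
lemma ringKrullDim_le_topologicalKrullDim_zeroLocus {A B : Type*} [CommRing A] [CommRing B]
    (f : A →+* B) (hf : Function.Surjective f) {s : Set A} (hs : ∀ a ∈ s, f a = 0) :
    ringKrullDim B ≤ topologicalKrullDim (PrimeSpectrum.zeroLocus s) := by
  rw [← topologicalKrullDim_zeroLocus_ker f hf]
  have hsub : PrimeSpectrum.zeroLocus (RingHom.ker f : Set A) ⊆ PrimeSpectrum.zeroLocus s :=
    PrimeSpectrum.zeroLocus_anti_mono fun a ha => hs a ha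
  exact (Topology.IsEmbedding.inclusion hsub).isInducing.topologicalKrullDim_le

lemma ringKrullDim_le_of_isIntegral {A B : Type*} [CommRing A] [CommRing B] (f : A →+* B)
    (hf : f.IsIntegral) : ringKrullDim B ≤ ringKrullDim A := by
  let _ : Algebra A B := f.toAlgebra
  have : Algebra.IsIntegral A B := ⟨hf⟩
  refine Order.krullDim_le_of_strictMono (PrimeSpectrum.comap f) fun p q hpq => ?_
  exact Ideal.IsIntegral.comap_lt_comap (R := A) (I := p.asIdeal) (J := q.asIdeal) hpq

/-- A finitely generated algebra over a field that embeds in the polynomial ring in `n` variables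
has Krull dimension at most `n`. -/
lemma ringKrullDim_le_of_injective_mvPolynomial {k R : Type} [Field k] [CommRing R] [Nontrivial R]
    [Algebra k R] [Algebra.FiniteType k R] {n : ℕ} (f : R →ₐ[k] MvPolynomial (Fin n) k)
    (hf : Function.Injective f) : ringKrullDim R ≤ n := by
  obtain ⟨s, g, hg, hint⟩ := exists_integral_inj_algHom_of_fg k R
  refine (ringKrullDim_le_of_isIntegral _ hint).trans ?_
  have h := trdeg_le_of_injective (f.comp g) (hf.comp hg)
  simp only [MvPolynomial.trdeg_of_isDomain, Cardinal.mk_fin, Cardinal.lift_natCast,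
    Nat.cast_le] at h
  simpa [MvPolynomial.ringKrullDim_of_isNoetherianRing] using h

end Dimension

section Truncation

open scoped Polynomial

variable {R : Type*} [CommRing R]

/-- The polynomial with coefficients `a 0, …, a (n - 1)`. -/
noncomputable def jetPoly {n : ℕ} (a : Fin n → R) : R[X] := ∑ l : Fin n, Polynomial.C (a l) * Polynomial.X ^ (l : ℕ)

lemma jetPoly_coeff {n : ℕ} (a : Fin n → R) (j : Fin n) : (jetPoly a).coeff j = a j := by
  simp [jetPoly, Polynomial.finsetSum_coeff, Polynomial.coeff_C_mul, Polynomial.coeff_X_pow,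
    Fin.val_inj]

lemma jetPoly_map {n : ℕ} {S : Type*} [CommRing S] (f : R →+* S) (a : Fin n → R) :
    (jetPoly a).map f = jetPoly fun l => f (a l) := by
  simp [jetPoly, Polynomial.map_sum]

lemma X_pow_dvd_sub_iff {n : ℕ} {p q : R[X]} :
    Polynomial.X ^ n ∣ p - q ↔ ∀ j : Fin n, p.coeff j = q.coeff j := by
  simp [Polynomial.X_pow_dvd_iff, sub_eq_zero, Fin.forall_iff]

lemma X_pow_dvd_sub_jetPoly {n : ℕ} (p : R[X]) :
    Polynomial.X ^ n ∣ p - jetPoly fun l : Fin n => p.coeff l :=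
  X_pow_dvd_sub_iff.2 fun j => (jetPoly_coeff (fun l : Fin n => p.coeff l) j).symm

lemma X_pow_dvd_jetPoly {n : ℕ} (a : Fin n → R) {d : ℕ} (h : ∀ l : Fin n, (l : ℕ) < d → a l = 0) :
    Polynomial.X ^ d ∣ jetPoly a := by
  refine Finset.dvd_sum fun l _ => ?_
  by_cases hl : (l : ℕ) < d
  · simp [h l hl]
  · exact (pow_dvd_pow Polynomial.X (not_lt.1 hl)).mul_left _

/-- A truncated solution of `x³ = y²`, `x² = z³` with invertible constant term of `x` is of the
form `(b⁶, b⁹, b⁴)`. -/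
lemma exists_monomial_parametrization {n : ℕ} {x y z : R[X]} (h₁ : Polynomial.X ^ n ∣ x ^ 3 - y ^ 2)
    (h₂ : Polynomial.X ^ n ∣ x ^ 2 - z ^ 3) (hx : IsUnit (x.coeff 0)) :
    ∃ b : R[X], Polynomial.X ^ n ∣ x - b ^ 6 ∧ Polynomial.X ^ n ∣ y - b ^ 9 ∧ Polynomial.X ^ n ∣ z - b ^ 4 := by
  have hcop : IsCoprime (Polynomial.X : R[X]) x := by
    obtain ⟨u, hu⟩ := hx
    refine ⟨-Polynomial.C (↑u⁻¹ : R) * x.divX, Polynomial.C (↑u⁻¹ : R), ?_⟩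
    have : (Polynomial.C (↑u⁻¹ : R) : R[X]) * Polynomial.C (x.coeff 0) = 1 := by
      rw [← Polynomial.C_mul, ← hu, Units.inv_mul, Polynomial.C_1]
    linear_combination this - Polynomial.C (↑u⁻¹ : R) * Polynomial.divX_mul_X_add x
  obtain ⟨u, v, huv⟩ := hcop.pow_left (m := n)
  simp only [← Ideal.mem_span_singleton, ← Ideal.Quotient.eq, map_pow] at h₁ h₂ ⊢
  refine ⟨y * z * v ^ 2, ?_⟩
  have hv := congrArg (Ideal.Quotient.mk (Ideal.span {Polynomial.X ^ n})) huv
  have h0 : Ideal.Quotient.mk (Ideal.span {(Polynomial.X : R[X]) ^ n}) Polynomial.X ^ n = 0 := by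
    rw [← map_pow]
    exact Ideal.Quotient.eq_zero_iff_mem.2 (Ideal.mem_span_singleton_self _)
  simp only [map_add, map_mul, map_pow, map_one, h0, mul_zero, zero_add] at hv ⊢
  generalize Ideal.Quotient.mk (Ideal.span {(Polynomial.X : R[X]) ^ n}) x = x' at *
  generalize Ideal.Quotient.mk (Ideal.span {(Polynomial.X : R[X]) ^ n}) y = y' at *
  generalize Ideal.Quotient.mk (Ideal.span {(Polynomial.X : R[X]) ^ n}) z = z' at *
  generalize Ideal.Quotient.mk (Ideal.span {(Polynomial.X : R[X]) ^ n}) v = v' at *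
  have hvx (k : ℕ) : v' ^ k * x' ^ k = 1 := by rw [← mul_pow, hv, one_pow]
  refine ⟨?_, ?_, ?_⟩
  · calc x' = x' * (v' ^ 12 * x' ^ 12) := by rw [hvx, mul_one]
      _ = (x' ^ 3) ^ 3 * (x' ^ 2) ^ 2 * v' ^ 12 := by ring
      _ = _ := by rw [h₁, h₂]; ring
  · calc y' = y' * (v' ^ 18 * x' ^ 18) := by rw [hvx, mul_one]
      _ = y' * (x' ^ 3) ^ 4 * (x' ^ 2) ^ 3 * v' ^ 18 := by ring
      _ = _ := by rw [h₁, h₂]; ring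
  · calc z' = z' * (v' ^ 8 * x' ^ 8) := by rw [hvx, mul_one]
      _ = z' * (x' ^ 3) ^ 2 * x' ^ 2 * v' ^ 8 := by ring
      _ = _ := by rw [h₁, h₂]; ring

lemma X_pow_dvd_pow_sub_pow {n : ℕ} {p q : R[X]} (h : Polynomial.X ^ n ∣ p - q) (k : ℕ) :
    Polynomial.X ^ n ∣ p ^ k - q ^ k :=
  h.trans (sub_dvd_pow_sub_pow p q k)

lemma coeff_mul_mem {T : Subring R} {n : ℕ} {p q : R[X]} (hp : ∀ j < n, p.coeff j ∈ T)
    (hq : ∀ j < n, q.coeff j ∈ T) : ∀ j < n, (p * q).coeff j ∈ T := by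
  intro j hj
  rw [Polynomial.coeff_mul]
  refine T.sum_mem fun i hi => ?_
  have := Finset.HasAntidiagonal.mem_antidiagonal.1 hi
  exact T.mul_mem (hp _ (by lia)) (hq _ (by lia))

lemma coeff_mem_of_mul {T : Subring R} {n : ℕ} {p q : R[X]} (hq : ∀ j < n, q.coeff j ∈ T)
    (hpq : ∀ j < n, (p * q).coeff j ∈ T) (hq0 : q.coeff 0 = 1) : ∀ j < n, p.coeff j ∈ T := by
  intro j
  induction j using Nat.strong_induction_on with
  | _ j ih =>
    intro hj
    have h := hpq j hj
    rw [Polynomial.coeff_mul, Finset.Nat.sum_antidiagonal_eq_sum_range_succ_mk,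
      Finset.sum_range_succ] at h
    simp only [Nat.sub_self, hq0, mul_one] at h
    refine (add_mem_cancel_left (T.sum_mem fun i hi => ?_)).1 h
    have := Finset.mem_range.1 hi
    exact T.mul_mem (ih i this (by lia)) (hq _ (by lia))

end Truncation

section JetScheme

open scoped Polynomial

/-- The substitution of generic `m`-jets `∑ X (i, l) tˡ` for the coordinates of `𝔸³`. -/
noncomputable def jetHom (m : ℕ) :
    MvPolynomial (Fin 3) ℂ →+* Polynomial (MvPolynomial (Fin 3 × Fin (m + 1)) ℂ) :=
  MvPolynomial.eval₂Hom ((Polynomial.C).comp (MvPolynomial.C))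
    (fun i : Fin 3 => ∑ l : Fin (m + 1),
      Polynomial.C (MvPolynomial.X (i, l)) * Polynomial.X ^ (l : ℕ))

/-- The ideal of the `m`-jet scheme of the curve `x³ = y²`, `x² = z³`. -/
noncomputable def jetIdeal (m : ℕ) : Ideal (MvPolynomial (Fin 3 × Fin (m + 1)) ℂ) :=
  Ideal.span { q | ∃ j : Fin (m + 1),
    q = (jetHom m (MvPolynomial.X 0 ^ 3 - MvPolynomial.X 1 ^ 2)).coeff j ∨
    q = (jetHom m (MvPolynomial.X 0 ^ 2 - MvPolynomial.X 2 ^ 3)).coeff j }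

/-- The coordinates of the base point of a jet. -/
noncomputable def originVars (m : ℕ) : Set (MvPolynomial (Fin 3 × Fin (m + 1)) ℂ ⧸ jetIdeal m) :=
  Set.range fun i : Fin 3 => Ideal.Quotient.mk (jetIdeal m) (MvPolynomial.X (i, 0))

/-- The `i`-th coordinate of the jet given by a ring homomorphism out of the coordinate ring of the
jet space. -/
noncomputable def jetCoord {m : ℕ} {R : Type*} [CommRing R]
    (g : MvPolynomial (Fin 3 × Fin (m + 1)) ℂ →+* R) (i : Fin 3) : R[X] :=
  jetPoly fun l => g (X (i, l))

lemma jetHom_X_map {m : ℕ} {R : Type*} [CommRing R]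
    (g : MvPolynomial (Fin 3 × Fin (m + 1)) ℂ →+* R) (i : Fin 3) :
    (jetHom m (X i)).map g = jetCoord g i := by
  have h : jetHom m (X i) = jetPoly fun l => X (i, l) := by simp [jetHom, jetPoly]
  rw [h, jetPoly_map, jetCoord]

/-- A ring homomorphism factors through the jet scheme iff the corresponding jet satisfies the
equations of the curve. -/
lemma jetIdeal_le_ker_iff {m : ℕ} {R : Type*} [CommRing R]
    (g : MvPolynomial (Fin 3 × Fin (m + 1)) ℂ →+* R) :
    jetIdeal m ≤ RingHom.ker g ↔
      Polynomial.X ^ (m + 1) ∣ jetCoord g 0 ^ 3 - jetCoord g 1 ^ 2 ∧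
      Polynomial.X ^ (m + 1) ∣ jetCoord g 0 ^ 2 - jetCoord g 2 ^ 3 := by
  have h (p : MvPolynomial (Fin 3) ℂ) (j : ℕ) :
      g ((jetHom m p).coeff j) = ((jetHom m p).map g).coeff j := (Polynomial.coeff_map g j).symm
  simp only [Polynomial.X_pow_dvd_iff, ← jetHom_X_map, ← Polynomial.map_pow, ← Polynomial.map_sub,
    ← map_pow, ← map_sub, ← h]
  rw [jetIdeal, Ideal.span_le]
  refine ⟨fun H => ⟨fun d hd => H ⟨⟨d, hd⟩, .inl rfl⟩, fun d hd => H ⟨⟨d, hd⟩, .inr rfl⟩⟩, ?_⟩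
  rintro ⟨h₁, h₂⟩ _ ⟨j, rfl | rfl⟩
  exacts [h₁ j j.2, h₂ j j.2]

/-- The fiber of the jet scheme over the origin contains a linear space of dimension `m + 2`. -/
lemma le_topologicalKrullDim_zeroLocus_originVars {m : ℕ} (hm : 1 ≤ m) :
    ((m + 2 : ℕ) : WithBot ℕ∞) ≤
      topologicalKrullDim (PrimeSpectrum.zeroLocus (originVars m)) := by
  let d : Fin 3 → ℕ := ![(m + 2) / 2, (m + 2) / 2, (m + 3) / 3]
  have hd (i : Fin 3) : 0 < d i ∧ d i ≤ m + 1 := by fin_cases i <;> simp [d] <;> lia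
  let σ := Σ i : Fin 3, Fin (m + 1 - d i)
  let g : MvPolynomial (Fin 3 × Fin (m + 1)) ℂ →ₐ[ℂ] MvPolynomial σ ℂ :=
    aeval fun p => if h : d p.1 ≤ p.2 then X ⟨p.1, ⟨p.2 - d p.1, by lia⟩⟩ else 0
  have hg (i : Fin 3) (l : Fin (m + 1)) (hl : (l : ℕ) < d i) : g (X (i, l)) = 0 := by
    simp [g, hl]
  have hdvd (i : Fin 3) (k : ℕ) (hk : m + 1 ≤ d i * k) :
      Polynomial.X ^ (m + 1) ∣ jetCoord (m := m) (g : _ →+* MvPolynomial σ ℂ) i ^ k := by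
    refine (pow_dvd_pow Polynomial.X hk).trans ?_
    rw [pow_mul]
    exact pow_dvd_pow_of_dvd (X_pow_dvd_jetPoly _ (hg i)) k
  have hker : jetIdeal m ≤ RingHom.ker (g : _ →+* MvPolynomial σ ℂ) := by
    rw [jetIdeal_le_ker_iff]
    constructor <;> refine dvd_sub (hdvd _ _ ?_) (hdvd _ _ ?_) <;> simp [d] <;> lia
  have hsurj : Function.Surjective (Ideal.Quotient.lift (jetIdeal m) _ hker) := by
    refine Ideal.Quotient.lift_surjective_of_surjective _ _ ?_
    suffices g.range = ⊤ from AlgHom.range_eq_top g |>.1 this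
    rw [eq_top_iff, ← MvPolynomial.adjoin_range_X, Algebra.adjoin_le_iff]
    rintro _ ⟨⟨i, k⟩, rfl⟩
    refine ⟨X (i, ⟨k + d i, by lia⟩), ?_⟩
    simp [g]
  refine le_trans ?_ (ringKrullDim_le_topologicalKrullDim_zeroLocus _ hsurj ?_)
  · rw [MvPolynomial.ringKrullDim_of_isNoetherianRing, ringKrullDim_eq_zero_of_field, zero_add]
    have : m + 2 ≤ Nat.card σ := by
      simp only [σ, Nat.card_eq_fintype_card, Fintype.card_sigma, Fintype.card_fin,
        Fin.sum_univ_three]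
      simp [d]
      lia
    exact_mod_cast this
  · rintro _ ⟨i, rfl⟩
    change g (X (i, (0 : Fin (m + 1)))) = 0
    exact hg i 0 (hd i).1

/-- The exponents of the monomial parametrization `(b⁶, b⁹, b⁴)` of the curve. -/
def curveExp : Fin 3 → ℕ := ![6, 9, 4]

/-- The monomial parametrization of jets of the curve by jets of the line, on coordinate rings. -/
noncomputable def jetParam (m : ℕ) :
    MvPolynomial (Fin 3 × Fin (m + 1)) ℂ →ₐ[ℂ] MvPolynomial (Fin (m + 1)) ℂ :=
  aeval fun p => (jetPoly X ^ curveExp p.1).coeff p.2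

lemma X_pow_dvd_pow_curveExp_sub_jetCoord {m : ℕ} {R : Type*} [CommRing R]
    (φ : MvPolynomial (Fin (m + 1)) ℂ →+* R) (i : Fin 3) :
    Polynomial.X ^ (m + 1) ∣ jetPoly (fun l => φ (X l)) ^ curveExp i -
      jetCoord (m := m) (φ.comp (jetParam m : _ →+* MvPolynomial (Fin (m + 1)) ℂ)) i := by
  rw [X_pow_dvd_sub_iff]
  intro j
  rw [jetCoord, jetPoly_coeff, ← jetPoly_map, ← Polynomial.map_pow, Polynomial.coeff_map]
  simp [jetParam]

lemma jetIdeal_le_ker_jetParam (m : ℕ) :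
    jetIdeal m ≤ RingHom.ker (jetParam m : _ →+* MvPolynomial (Fin (m + 1)) ℂ) := by
  rw [jetIdeal_le_ker_iff]
  have h (i : Fin 3) (k : ℕ) := X_pow_dvd_pow_sub_pow
    (X_pow_dvd_pow_curveExp_sub_jetCoord (RingHom.id (MvPolynomial (Fin (m + 1)) ℂ)) i) k
  simp only [RingHom.id_comp, RingHom.id_apply, ← pow_mul] at h
  constructor
  · simpa [curveExp] using dvd_sub (h 1 2) (h 0 3)
  · simpa [curveExp] using dvd_sub (h 2 3) (h 0 2)

/-- A jet whose base point is not the origin factors through the monomial parametrization. -/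
lemma exists_comp_jetParam_eq {m : ℕ} {R : Type*} [CommRing R]
    (g : MvPolynomial (Fin 3 × Fin (m + 1)) ℂ →+* R) (hg : jetIdeal m ≤ RingHom.ker g)
    (hu : IsUnit (g (X (0, 0)))) :
    ∃ φ : MvPolynomial (Fin (m + 1)) ℂ →+* R,
      φ.comp (jetParam m : _ →+* MvPolynomial (Fin (m + 1)) ℂ) = g := by
  obtain ⟨h₁, h₂⟩ := (jetIdeal_le_ker_iff g).1 hg
  have hx : IsUnit ((jetCoord g 0).coeff 0) := by
    have := jetPoly_coeff (fun l => g (X (0, l))) (0 : Fin (m + 1))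
    rw [jetCoord]
    simp_all
  obtain ⟨b, hb₀, hb₁, hb₂⟩ := exists_monomial_parametrization h₁ h₂ hx
  have hb (i : Fin 3) : Polynomial.X ^ (m + 1) ∣ jetCoord g i - b ^ curveExp i := by
    fin_cases i
    exacts [hb₀, hb₁, hb₂]
  refine ⟨eval₂Hom (g.comp C) fun l => b.coeff l, ?_⟩
  refine MvPolynomial.ringHom_ext (fun r => ?_) fun ⟨i, l⟩ => ?_
  · simp [jetParam]
  · have h := X_pow_dvd_pow_curveExp_sub_jetCoord
      (eval₂Hom (g.comp C) fun l : Fin (m + 1) => b.coeff l) i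
    simp only [coe_eval₂Hom, eval₂_X] at h
    have h' := X_pow_dvd_pow_sub_pow (X_pow_dvd_sub_jetPoly (n := m + 1) b) (curveExp i)
    have := X_pow_dvd_sub_iff.1 (dvd_add (dvd_add (hb i) h') h |>.trans (by
      rw [sub_add_sub_cancel, sub_add_sub_cancel])) l
    simpa [jetCoord, jetPoly_coeff] using this.symm

/-- The parametrization of jets, on the coordinate ring of the jet scheme. -/
noncomputable def jetSchemeParam (m : ℕ) :
    (MvPolynomial (Fin 3 × Fin (m + 1)) ℂ ⧸ jetIdeal m) →ₐ[ℂ] MvPolynomial (Fin (m + 1)) ℂ :=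
  Ideal.Quotient.liftₐ (jetIdeal m) (jetParam m) (jetIdeal_le_ker_jetParam m)

lemma jetParam_X_zero (m : ℕ) (i : Fin 3) : jetParam m (X (i, 0)) = X 0 ^ curveExp i := by
  have h := jetPoly_coeff (X : Fin (m + 1) → MvPolynomial (Fin (m + 1)) ℂ) 0
  simp only [Fin.val_zero] at h
  simp [jetParam, Polynomial.coeff_zero_eq_eval_zero, Polynomial.eval_pow] at h ⊢
  rw [h]

/-- The jets not based at the origin are dense in the image of the parametrization. -/
lemma closure_compl_zeroLocus_originVars (m : ℕ) :
    closure (PrimeSpectrum.zeroLocus (originVars m))ᶜ =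
      PrimeSpectrum.zeroLocus (RingHom.ker (jetSchemeParam m) :
        Set (MvPolynomial (Fin 3 × Fin (m + 1)) ℂ ⧸ jetIdeal m)) := by
  set I := RingHom.ker (jetSchemeParam m) with hI
  have hprime : I.IsPrime := RingHom.ker_isPrime _
  refine subset_antisymm (closure_minimal ?_ (PrimeSpectrum.isClosed_zeroLocus _)) ?_
  · intro p hp f hf
    let g := (algebraMap _ p.asIdeal.ResidueField).comp (Ideal.Quotient.mk (jetIdeal m))
    have hg : jetIdeal m ≤ RingHom.ker g := fun q hq => by
      simp [g, RingHom.mem_ker, Ideal.Quotient.eq_zero_iff_mem.2 hq]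
    have hu : IsUnit (g (X (0, 0))) := by
      rw [isUnit_iff_ne_zero]
      intro h0
      obtain ⟨h₁, h₂⟩ := (jetIdeal_le_ker_iff g).1 hg
      have hc (i : Fin 3) : (jetCoord g i).coeff 0 = g (X (i, 0)) :=
        jetPoly_coeff (fun l => g (X (i, l))) (0 : Fin (m + 1))
      have e₁ := Polynomial.X_pow_dvd_iff.1 h₁ 0 (by lia)
      have e₂ := Polynomial.X_pow_dvd_iff.1 h₂ 0 (by lia)
      simp only [Polynomial.coeff_zero_eq_eval_zero] at hc e₁ e₂
      simp [hc, h0] at e₁ e₂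
      refine hp ?_
      rintro _ ⟨i, rfl⟩
      rw [SetLike.mem_coe, ← Ideal.algebraMap_residueField_eq_zero]
      change g (X (i, 0)) = 0
      fin_cases i
      exacts [h0, e₁, e₂]
    obtain ⟨φ, hφ⟩ := exists_comp_jetParam_eq g hg hu
    obtain ⟨f, rfl⟩ := Ideal.Quotient.mk_surjective f
    rw [SetLike.mem_coe, ← Ideal.algebraMap_residueField_eq_zero]
    change g f = 0
    have hf' : jetParam m f = 0 := hf
    rw [← hφ]
    simp [hf']
  · rw [← PrimeSpectrum.closure_singleton ⟨I, hprime⟩]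
    refine closure_mono (Set.singleton_subset_iff.2 fun h => ?_)
    have h0 : jetParam m (X (0, 0)) = 0 := h ⟨0, rfl⟩
    rw [jetParam_X_zero] at h0
    exact pow_ne_zero _ (X_ne_zero _) h0

/-- Setting `b₀ = 1` maps the image of the parametrization onto a polynomial ring in `m`
variables. -/
lemma mem_range_aeval_cons_comp_jetParam {m : ℕ} (k : Fin m) :
    X k ∈ ((aeval (Fin.cons 1 X : Fin (m + 1) → MvPolynomial (Fin m) ℂ)).comp
      (jetParam m)).range := by
  set τ : MvPolynomial (Fin (m + 1)) ℂ →ₐ[ℂ] MvPolynomial (Fin m) ℂ :=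
    aeval (Fin.cons 1 X : Fin (m + 1) → MvPolynomial (Fin m) ℂ) with hτ
  set J : (MvPolynomial (Fin m) ℂ)[X] := jetPoly fun l : Fin (m + 1) => τ (X l) with hJ
  let T : Subring (MvPolynomial (Fin m) ℂ) := (τ.comp (jetParam m)).range.toSubring
  have hT (i : Fin 3) : ∀ j < m + 1, (J ^ curveExp i).coeff j ∈ T := fun j hj => by
    have := X_pow_dvd_sub_iff.1
      (X_pow_dvd_pow_curveExp_sub_jetCoord (τ : _ →+* MvPolynomial (Fin m) ℂ) i) ⟨j, hj⟩
    rw [jetCoord, jetPoly_coeff] at this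
    exact ⟨X (i, ⟨j, hj⟩), this.symm⟩
  have hc (l : Fin (m + 1)) : J.coeff l = τ (X l) := jetPoly_coeff (fun l => τ (X l)) l
  have hJ0 : J.coeff 0 = 1 := by
    have := hc 0
    simpa [hτ] using this
  have hmem := coeff_mem_of_mul (p := J) (coeff_mul_mem (hT 0) (hT 0)) (fun j hj => by
    have : J * (J ^ curveExp 0 * J ^ curveExp 0) = J ^ curveExp 1 * J ^ curveExp 2 := by
      simp only [curveExp, Matrix.cons_val]
      ring
    rw [this]
    exact coeff_mul_mem (hT 1) (hT 2) j hj) (by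
    rw [Polynomial.coeff_zero_eq_eval_zero] at hJ0 ⊢
    simp [hJ0])
  have := hmem (k.succ : Fin (m + 1)) k.succ.2
  rw [hc] at this
  have hX : τ (X k.succ) = X k := by simp [hτ]
  rwa [hX] at this

lemma ringKrullDim_range_jetSchemeParam (m : ℕ) :
    ringKrullDim (jetSchemeParam m).range = ((m + 1 : ℕ) : WithBot ℕ∞) := by
  refine le_antisymm ?_ ?_
  · have : Algebra.FiniteType ℂ (jetSchemeParam m).range :=
      .of_surjective (jetSchemeParam m).rangeRestrict (jetSchemeParam m).rangeRestrict_surjective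
    exact ringKrullDim_le_of_injective_mvPolynomial (jetSchemeParam m).range.val
      Subtype.val_injective
  · let τ : MvPolynomial (Fin (m + 1)) ℂ →ₐ[ℂ] MvPolynomial (Fin m) ℂ :=
      aeval (Fin.cons 1 X : Fin (m + 1) → MvPolynomial (Fin m) ℂ)
    let ρ : (jetSchemeParam m).range →ₐ[ℂ] MvPolynomial (Fin m) ℂ :=
      τ.comp (jetSchemeParam m).range.val
    have hρ : Function.Surjective ρ := by
      rw [← AlgHom.range_eq_top, eq_top_iff, ← MvPolynomial.adjoin_range_X, Algebra.adjoin_le_iff]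
      rintro _ ⟨k, rfl⟩
      obtain ⟨f, hf⟩ := mem_range_aeval_cons_comp_jetParam k
      exact ⟨⟨_, Ideal.Quotient.mk (jetIdeal m) f, rfl⟩, hf⟩
    let r : (jetSchemeParam m).range :=
      ⟨X 0 ^ 6, Ideal.Quotient.mk (jetIdeal m) (X (0, 0)), jetParam_X_zero m 0⟩
    have hr : r - 1 ≠ 0 := by
      intro h
      have h' : (X 0 ^ 6 - 1 : MvPolynomial (Fin (m + 1)) ℂ) = 0 := congrArg Subtype.val h
      simpa using congrArg (eval fun _ => (0 : ℂ)) h'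
    have h := ringKrullDim_succ_le_of_surjective (ρ : _ →+* MvPolynomial (Fin m) ℂ) hρ
      (mem_nonZeroDivisors_of_ne_zero hr) (by simp [ρ, τ, r])
    simpa [MvPolynomial.ringKrullDim_of_isNoetherianRing] using h

lemma topologicalKrullDim_closure_compl_zeroLocus_originVars (m : ℕ) :
    topologicalKrullDim (closure (PrimeSpectrum.zeroLocus (originVars m))ᶜ : Set _) =
      ((m + 1 : ℕ) : WithBot ℕ∞) := by
  have hker : RingHom.ker (jetSchemeParam m) =
      RingHom.ker (jetSchemeParam m).rangeRestrict.toRingHom := by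
    ext f
    simp [RingHom.mem_ker, Subtype.ext_iff]
  rw [closure_compl_zeroLocus_originVars, hker, ← ringKrullDim_range_jetSchemeParam]
  exact topologicalKrullDim_zeroLocus_ker _ (jetSchemeParam m).rangeRestrict_surjective

lemma not_irreducibleSpace_jetScheme {m : ℕ} (hm : 1 ≤ m) : ¬ IrreducibleSpace
    (PrimeSpectrum (MvPolynomial (Fin 3 × Fin (m + 1)) ℂ ⧸ jetIdeal m)) := by
  intro _
  have hdim := topologicalKrullDim_closure_compl_zeroLocus_originVars m
  have hne : ((PrimeSpectrum.zeroLocus (originVars m))ᶜ).Nonempty := by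
    rw [← closure_nonempty_iff, closure_compl_zeroLocus_originVars]
    exact ⟨⟨_, RingHom.ker_isPrime (jetSchemeParam m)⟩, fun _ h => h⟩
  rw [((PrimeSpectrum.isClosed_zeroLocus _).isOpen_compl.dense hne).closure_eq,
    (Homeomorph.Set.univ _).isHomeomorph.topologicalKrullDim_eq] at hdim
  have h := (le_topologicalKrullDim_zeroLocus_originVars hm).trans
    (topologicalKrullDim_subspace_le _ _)
  rw [hdim] at h
  have : m + 2 ≤ m + 1 := by exact_mod_cast h
  lia

end JetScheme

/-- Let `X ⊂ 𝔸³` over `ℂ` be the curve `x³ − y² = 0`, `x² − z³ = 0`.  For every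
`m ≥ 1`, in the `m`-jet scheme `X_m = Spec (S/I_m)` (with `S` the polynomial ring in the jet
variables `X (i, l)`, `0 ≤ l ≤ m`, and `I_m` spanned by the coefficients of `t⁰,…,tᵐ` of the
two defining equations evaluated on jets), the fiber `π_m⁻¹(0)` over the origin — the zero
locus of the degree-zero variables `X (i, 0)` — has dimension `≥ m + 2`, while the closure of
`π_m⁻¹(X_reg)` — the closure of the complement of that zero locus — has dimension `m + 1`;
hence `X_m` is reducible (not irreducible) for every `m ≥ 1`. -/
theorem stmt10 (m : ℕ) (hm : 1 ≤ m) :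
    let S := MvPolynomial (Fin 3 × Fin (m + 1)) ℂ
    let Φ : MvPolynomial (Fin 3) ℂ →+* Polynomial S :=
      MvPolynomial.eval₂Hom ((Polynomial.C).comp (MvPolynomial.C))
        (fun i : Fin 3 => ∑ l : Fin (m + 1),
          Polynomial.C (MvPolynomial.X (i, l)) * Polynomial.X ^ (l : ℕ))
    let F₁ : MvPolynomial (Fin 3) ℂ := MvPolynomial.X 0 ^ 3 - MvPolynomial.X 1 ^ 2
    let F₂ : MvPolynomial (Fin 3) ℂ := MvPolynomial.X 0 ^ 2 - MvPolynomial.X 2 ^ 3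
    let Im : Ideal S := Ideal.span
      { q : S | ∃ j : Fin (m + 1), q = (Φ F₁).coeff j ∨ q = (Φ F₂).coeff j }
    let Am := S ⧸ Im
    let originVars : Set Am :=
      Set.range fun i : Fin 3 => Ideal.Quotient.mk Im (MvPolynomial.X (i, 0))
    topologicalKrullDim (PrimeSpectrum.zeroLocus originVars) ≥
        ((m + 2 : ℕ) : WithBot (WithTop ℕ)) ∧
    topologicalKrullDim
        (closure ((PrimeSpectrum.zeroLocus originVars)ᶜ : Set (PrimeSpectrum Am))) =
        ((m + 1 : ℕ) : WithBot (WithTop ℕ)) ∧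
    ¬ IrreducibleSpace (PrimeSpectrum Am) := by
  exact ⟨le_topologicalKrullDim_zeroLocus_originVars hm,
    topologicalKrullDim_closure_compl_zeroLocus_originVars m, not_irreducibleSpace_jetScheme hm⟩
end

section
/- Let X ⊂ 𝔸ⁿ_ℂ (n ≥ 3) be the quadric cone x₁² + ⋯ + xₙ² = 0 and X₁ ⊂ 𝔸^{2n} its first jet scheme, defined by Σ xᵢ² = 0 and Σ xᵢ xᵢ^(1) = 0. Then the singular locus of X₁ is the linear subspace {x₁ = ⋯ = xₙ = 0} ≅ 𝔸ⁿ, of dimension n, while dim X₁ = 2(n−1); in particular for n = 3 the jet scheme X₁ of the normal surface X is not normal (its singular locus has codimension 1... dimension 2n−2=4 vs singular locus dimension 3). -/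
open MvPolynomial

/-- A Noetherian local ring is regular if its maximal ideal is generated by
`dim R` many elements. -/
def IsRegularLocal (R : Type*) [CommRing R] [IsLocalRing R] : Prop :=
  ∃ T : Finset R, Ideal.span (T : Set R) = IsLocalRing.maximalIdeal R ∧
    (T.card : WithBot (WithTop ℕ)) = ringKrullDim R

open IsLocalRing in
theorem IsRegularLocalRing.isRegularLocal {R : Type*} [CommRing R] [IsRegularLocalRing R] :
    IsRegularLocal R := by
  obtain ⟨T, hT, hspan⟩ := Submodule.FG.exists_span_finset_card_eq_spanFinrank
    (IsNoetherian.noetherian (maximalIdeal R))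
  refine ⟨T, hspan, ?_⟩
  rw [hT]
  exact (isRegularLocalRing_iff R).mp inferInstance

section QuotientByTwoElements

open IsLocalRing

variable {R R' : Type*} [CommRing R] [CommRing R'] [IsLocalRing R'] {φ : R →+* R'} {f g : R}

/-- The quotient of a regular local ring by two elements that are independent in the cotangent
space is regular. -/
theorem IsRegularLocalRing.of_surjective_of_ker_eq_span_pair [IsRegularLocalRing R]
    (hφ : Function.Surjective φ) (hker : RingHom.ker φ = Ideal.span {f, g})
    (hf : f ∈ maximalIdeal R) (hg : g ∈ maximalIdeal R)
    (hind : ∀ a b, a * f + b * g ∈ maximalIdeal R ^ 2 →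
      a ∈ maximalIdeal R ∧ b ∈ maximalIdeal R) :
    IsRegularLocalRing R' := by
  classical
  have : IsNoetherianRing R' := isNoetherianRing_of_surjective R R' φ hφ
  let π := (maximalIdeal R).toCotangent
  let W : Submodule (ResidueField R) (CotangentSpace R) :=
    Submodule.span _ {π ⟨f, hf⟩, π ⟨g, hg⟩}
  have hWrank : Module.finrank (ResidueField R) W = 2 := by
    have hli : LinearIndependent (ResidueField R) ![π ⟨f, hf⟩, π ⟨g, hg⟩] := by
      rw [LinearIndependent.pair_iff]
      intro s t hst
      obtain ⟨a, rfl⟩ := residue_surjective s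
      obtain ⟨b, rfl⟩ := residue_surjective t
      have h : π (a • ⟨f, hf⟩ + b • ⟨g, hg⟩) = 0 := by
        rw [map_add, map_smul, map_smul]
        exact hst
      rw [Ideal.toCotangent_eq_zero] at h
      simpa only [residue_eq_zero_iff] using hind a b h
    have := finrank_span_eq_card hli
    rw [Matrix.range_cons, Matrix.range_cons, Matrix.range_empty, Set.union_empty] at this
    exact this
  obtain ⟨U, hU⟩ := W.exists_isCompl
  let b := Module.finBasis (ResidueField R) U
  choose t ht using fun i => (maximalIdeal R).toCotangent_surjective (b i : CotangentSpace R)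
  have hspan : Submodule.span R ({⟨f, hf⟩, ⟨g, hg⟩} ∪ Set.range t) = ⊤ := by
    rw [← CotangentSpace.span_image_eq_top_iff, Set.image_union, Submodule.span_union,
      ← Set.range_comp, Set.image_pair]
    have hb : Submodule.span (ResidueField R)
        (Set.range ((maximalIdeal R).toCotangent ∘ t)) = U := by
      have : (maximalIdeal R).toCotangent ∘ t = U.subtype ∘ b := funext ht
      rw [this, Set.range_comp, Submodule.span_image, b.span_eq, Submodule.map_top,
        Submodule.range_subtype]
    rw [hb]
    exact hU.sup_eq_top
  have hmax : maximalIdeal R = Ideal.span {f, g} ⊔ Ideal.span (Set.range fun i => (t i : R)) := by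
    have := congrArg (Submodule.map (maximalIdeal R).subtype) hspan
    rw [Submodule.map_top, Submodule.range_subtype, Submodule.map_span, Set.image_union,
      Submodule.span_union, Set.image_pair, ← Set.range_comp] at this
    exact this.symm
  have hmax' : maximalIdeal R' = Ideal.span (Set.range fun i => φ (t i)) := by
    rw [← map_maximalIdeal_of_surjective φ hφ, congrArg (Ideal.map φ) hmax, Ideal.map_sup, ← hker,
      (Ideal.map_eq_bot_iff_le_ker φ).mpr le_rfl, bot_sup_eq, Ideal.map_span, ← Set.range_comp]
    rfl
  apply IsRegularLocalRing.of_spanFinrank_maximalIdeal_le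
  have hle : (maximalIdeal R').spanFinrank ≤ Module.finrank (ResidueField R) U := by
    rw [hmax']
    refine (Submodule.spanFinrank_span_le_ncard_of_finite (Set.finite_range _)).trans ?_
    rw [← Set.image_univ]
    exact (Set.ncard_image_le Set.finite_univ).trans (by simp)
  have hsum := Submodule.finrank_add_eq_of_isCompl hU
  have hreg := (iff_finrank_cotangentSpace R).mp inferInstance
  have hdim : ringKrullDim R ≤ ringKrullDim R' + 2 := by
    refine (ringKrullDim_le_ringKrullDim_quotient_add_encard {f, g} ?_).trans ?_
    · rw [IsLocalRing.ringJacobson_eq_maximalIdeal]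
      rintro x (rfl | rfl) <;> assumption
    · rw [← hker, ringKrullDim_eq_of_ringEquiv (RingHom.quotientKerEquivOfSurjective hφ)]
      gcongr
      have : ({f, g} : Set R).encard ≤ 2 :=
        (Set.encard_insert_le {g} f).trans (by simp [one_add_one_eq_two])
      exact WithBot.coe_le_coe.mpr this
  rw [← hreg, ← hsum, hWrank, add_comm] at hdim
  have hdim' : ((Module.finrank (ResidueField R) U : ℕ) : WithBot ℕ∞) ≤ ringKrullDim R' :=
    ENat.WithBot.add_le_add_natCast_right_iff (c := 2) |>.mp (by rw [Nat.cast_add] at hdim; exact hdim)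
  exact le_trans (Nat.cast_le.mpr hle) hdim'

/-- If one of the two equations lies in the square of the maximal ideal and the dimension drops
by two, then the quotient is not regular. -/
theorem not_isRegularLocal_of_ker_eq_span_pair [IsLocalRing R] [IsNoetherianRing R]
    (hφ : Function.Surjective φ) (hker : RingHom.ker φ = Ideal.span {f, g})
    (hf : f ∈ maximalIdeal R ^ 2) (hg : g ∈ maximalIdeal R)
    (hdim : ringKrullDim R' + 2 ≤ ringKrullDim R) : ¬ IsRegularLocal R' := by
  classical
  rintro ⟨T, hT, hcard⟩
  obtain ⟨s, hs⟩ := hφ.hasRightInverse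
  have hsup : maximalIdeal R ≤ Ideal.span (insert g (T.image s) : Finset R) ⊔
      maximalIdeal R • maximalIdeal R := by
    have h1 : maximalIdeal R ≤ Ideal.span (T.image s : Finset R) ⊔ RingHom.ker φ := by
      intro x hx
      have hx' : φ x ∈ (Ideal.span (T.image s : Finset R)).map φ := by
        have : (Ideal.span (T.image s : Finset R)).map φ = maximalIdeal R' := by
          rw [Ideal.map_span, ← hT]
          congr 1
          ext y
          simp [hs _]
        rw [this, ← map_maximalIdeal_of_surjective φ hφ]
        exact Ideal.mem_map_of_mem φ hx
      rw [← Ideal.mem_comap, Ideal.comap_map_of_surjective' φ hφ] at hx'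
      exact hx'
    refine h1.trans (sup_le ?_ ?_)
    · refine le_sup_of_le_left (Ideal.span_mono ?_)
      simp
    · rw [hker, Ideal.span_le]
      rintro x (rfl | rfl)
      · rw [smul_eq_mul, ← pow_two]
        exact Ideal.mem_sup_right hf
      · exact Ideal.mem_sup_left (Ideal.subset_span (by simp))
  have hle := Submodule.le_of_le_smul_of_le_jacobson_bot (IsNoetherian.noetherian _)
    (IsLocalRing.jacobson_eq_maximalIdeal _ bot_ne_top).ge hsup
  have hge : Ideal.span (insert g (T.image s) : Finset R) ≤ maximalIdeal R := by
    rw [Ideal.span_le]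
    intro x hx
    simp only [Finset.coe_insert, Finset.coe_image, Set.mem_insert_iff, Set.mem_image] at hx
    obtain rfl | ⟨y, hy, rfl⟩ := hx
    · exact hg
    · have : y ∈ maximalIdeal R' := hT ▸ Ideal.subset_span hy
      rw [SetLike.mem_coe]
      rw [mem_maximalIdeal, mem_nonunits_iff] at this ⊢
      intro hu
      exact this (hs y ▸ hu.map φ)
  have hbound : (maximalIdeal R).spanFinrank ≤ T.card + 1 := by
    rw [hle.antisymm hge]
    refine (Submodule.spanFinrank_span_le_ncard_of_finite (Finset.finite_toSet _)).trans ?_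
    rw [Set.ncard_coe_finset]
    exact (Finset.card_insert_le _ _).trans (by gcongr; exact Finset.card_image_le)
  have hd := hdim.trans (ringKrullDim_le_spanFinrank_maximalIdeal R)
  have : (T.card : WithBot ℕ∞) = ringKrullDim R' := hcard
  rw [← this] at hd
  have : T.card + 2 ≤ (maximalIdeal R).spanFinrank := by exact_mod_cast hd
  omega

end QuotientByTwoElements

section Localization

variable {R R' : Type*} [CommRing R] [CommRing R'] {φ : R →+* R'}

theorem Localization.localRingHom_surjective_of_surjective (hφ : Function.Surjective φ)
    (p : Ideal R') [p.IsPrime] :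
    Function.Surjective (Localization.localRingHom (p.comap φ) p φ rfl) := by
  intro y
  obtain ⟨b, t, rfl⟩ := IsLocalization.exists_mk'_eq p.primeCompl y
  obtain ⟨a, rfl⟩ := hφ b
  obtain ⟨⟨s, hs⟩⟩ : Nonempty {s // φ s = t} := let ⟨s, hs⟩ := hφ t; ⟨s, hs⟩
  have hsp : s ∈ (p.comap φ).primeCompl := fun h => t.2 (hs ▸ h)
  refine ⟨IsLocalization.mk' _ a ⟨s, hsp⟩, ?_⟩
  rw [Localization.localRingHom_mk']
  congr 1
  exact Subtype.ext hs

theorem Localization.ker_localRingHom_of_surjective (hφ : Function.Surjective φ)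
    (p : Ideal R') [p.IsPrime] :
    RingHom.ker (Localization.localRingHom (p.comap φ) p φ rfl) =
      (RingHom.ker φ).map (algebraMap R (Localization.AtPrime (p.comap φ))) := by
  apply le_antisymm
  · intro x hx
    obtain ⟨a, s, rfl⟩ := IsLocalization.exists_mk'_eq (p.comap φ).primeCompl x
    rw [RingHom.mem_ker, Localization.localRingHom_mk', IsLocalization.mk'_eq_zero_iff] at hx
    obtain ⟨⟨t, ht⟩, hta⟩ := hx
    obtain ⟨t, rfl⟩ := hφ t
    rw [IsLocalization.mk'_mem_map_algebraMap_iff]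
    exact ⟨t, ht, by simpa [RingHom.mem_ker] using hta⟩
  · rw [Ideal.map_le_iff_le_comap]
    intro x hx
    rw [RingHom.mem_ker] at hx
    rw [Ideal.mem_comap, RingHom.mem_ker, Localization.localRingHom_to_map, hx, map_zero]

end Localization

/-- If every prime containing the kernel of a surjection has height at least `c`, then heights
drop by at least `c` along the surjection. -/
theorem Ideal.height_add_le_height_comap {R R' : Type*} [CommRing R] [CommRing R'] {φ : R →+* R'}
    (hφ : Function.Surjective φ) {c : ℕ∞}
    (hc : ∀ (q : Ideal R') [q.IsPrime], c ≤ (q.comap φ).height) (p : Ideal R') [p.IsPrime] :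
    p.height + c ≤ (p.comap φ).height := by
  have key : ∀ (n : ℕ) (q : PrimeSpectrum R'), (n : ℕ∞) ≤ Order.height q →
      n + c ≤ (q.asIdeal.comap φ).height := by
    intro n
    induction n with
    | zero => intro q _; simpa using hc q.asIdeal
    | succ n ih =>
      intro q hq
      obtain ⟨r, hr, hnr⟩ : ∃ r < q, (n : ℕ∞) ≤ Order.height r := by
        by_contra! h
        have := Order.height_le_coe_iff.mpr h
        have := hq.trans this
        norm_cast at this
        omega
      have hlt : r.asIdeal.comap φ < q.asIdeal.comap φ :=
        (Monotone.strictMono_of_injective (fun _ _ => Ideal.comap_mono)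
          (Ideal.comap_injective_of_surjective φ hφ)) hr
      calc ((n + 1 : ℕ) : ℕ∞) + c = n + c + 1 := by push_cast; ring
        _ ≤ (r.asIdeal.comap φ).height + 1 := by gcongr; exact ih r hnr
        _ ≤ _ := Ideal.height_add_one_le_of_lt_of_isPrime hlt
  have hp := PrimeSpectrum.height_eq_orderHeight ⟨p, inferInstance⟩
  cases h : p.height with
  | top =>
    have htop : (p.comap φ).height = ⊤ := by
      rw [ENat.eq_top_iff_forall_ge]
      intro m
      refine le_trans le_self_add (key m ⟨p, inferInstance⟩ ?_)
      rw [← hp]; simp [h]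
    simp [htop]
  | coe n => exact key n ⟨p, inferInstance⟩ (by rw [← hp]; exact h.ge)

section FirstJetScheme

/-- The equation `Σ xᵢ²` of the quadric cone. -/
noncomputable def coneEquation (n : ℕ) : MvPolynomial (Fin n ⊕ Fin n) ℂ :=
  ∑ i : Fin n, X (Sum.inl i) ^ 2

/-- The equation `Σ xᵢ xᵢ⁽¹⁾` of the tangent vectors to the quadric cone. -/
noncomputable def tangentEquation (n : ℕ) : MvPolynomial (Fin n ⊕ Fin n) ℂ :=
  ∑ i : Fin n, X (Sum.inl i) * X (Sum.inr i)

variable {n : ℕ}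

theorem irreducible_tangentEquation (hn : 2 ≤ n) : Irreducible (tangentEquation n) := by
  have h : tangentEquation n =
      sumSMulXSMulY (Finsupp.equivFunOnFinite.symm fun _ : Fin n => (1 : ℂ)) := by
    rw [sumSMulXSMulY, Finsupp.linearCombination_apply, Finsupp.sum_fintype _ _ (by simp)]
    simp [tangentEquation]
  rw [h]
  refine irreducible_sumSMulXSMulY _ ?_ fun r hr => ?_
  · refine ⟨⟨0, by omega⟩, by simp, ⟨1, by omega⟩, by simp, by simp⟩
  · exact isUnit_of_dvd_one (by simpa using hr ⟨0, by omega⟩)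

theorem not_tangentEquation_dvd_coneEquation (hn : 1 ≤ n) :
    ¬ tangentEquation n ∣ coneEquation n := by
  intro h
  have := map_dvd (eval (Sum.elim (Pi.single ⟨0, by omega⟩ 1) 0 : Fin n ⊕ Fin n → ℂ)) h
  simp [tangentEquation, coneEquation, Pi.single_apply] at this

theorem two_le_height_of_mem (hn : 2 ≤ n) {P : Ideal (MvPolynomial (Fin n ⊕ Fin n) ℂ)}
    [P.IsPrime] (hf : coneEquation n ∈ P) (hg : tangentEquation n ∈ P) : 2 ≤ P.height := by
  have hirr := irreducible_tangentEquation hn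
  have hprime : (Ideal.span {tangentEquation n}).IsPrime :=
    (Ideal.span_singleton_prime hirr.ne_zero).mpr hirr.prime
  have h0 : (⊥ : Ideal (MvPolynomial (Fin n ⊕ Fin n) ℂ)) < Ideal.span {tangentEquation n} := by
    rw [bot_lt_iff_ne_bot, Ne, Ideal.span_singleton_eq_bot]
    exact hirr.ne_zero
  have h1 : Ideal.span {tangentEquation n} < P := by
    refine lt_of_le_of_ne ((Ideal.span_singleton_le_iff_mem P).mpr hg) ?_
    rintro rfl
    exact not_tangentEquation_dvd_coneEquation (by omega) (Ideal.mem_span_singleton.mp hf)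
  calc (2 : ℕ∞) = 0 + 1 + 1 := by norm_num
    _ ≤ (⊥ : Ideal (MvPolynomial (Fin n ⊕ Fin n) ℂ)).height + 1 + 1 := by gcongr; exact zero_le
    _ ≤ (Ideal.span {tangentEquation n}).height + 1 := by
      gcongr; exact Ideal.height_add_one_le_of_lt_of_isPrime h0
    _ ≤ P.height := Ideal.height_add_one_le_of_lt_of_isPrime h1

/-- The coordinate ring of the first jet scheme of the quadric cone. -/
abbrev JetRing (n : ℕ) : Type :=
  MvPolynomial (Fin n ⊕ Fin n) ℂ ⧸ Ideal.span {coneEquation n, tangentEquation n}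

/-- The projection of the polynomial ring onto the coordinate ring of the jet scheme. -/
noncomputable abbrev JetRing.mk (n : ℕ) : MvPolynomial (Fin n ⊕ Fin n) ℂ →+* JetRing n :=
  Ideal.Quotient.mk _

namespace JetRing

theorem mk_surjective : Function.Surjective (mk n) := Ideal.Quotient.mk_surjective

theorem mk_coneEquation : mk n (coneEquation n) = 0 :=
  Ideal.Quotient.eq_zero_iff_mem.mpr (Ideal.subset_span (by simp))

theorem mk_tangentEquation : mk n (tangentEquation n) = 0 :=
  Ideal.Quotient.eq_zero_iff_mem.mpr (Ideal.subset_span (by simp))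

theorem coneEquation_mem_comap (p : Ideal (JetRing n)) : coneEquation n ∈ p.comap (mk n) := by
  rw [Ideal.mem_comap, mk_coneEquation]
  exact p.zero_mem

theorem tangentEquation_mem_comap (p : Ideal (JetRing n)) :
    tangentEquation n ∈ p.comap (mk n) := by
  rw [Ideal.mem_comap, mk_tangentEquation]
  exact p.zero_mem

theorem height_add_two_le (hn : 2 ≤ n) (p : Ideal (JetRing n)) [p.IsPrime] :
    p.height + 2 ≤ (p.comap (mk n)).height :=
  Ideal.height_add_le_height_comap mk_surjective (fun q _ =>
    two_le_height_of_mem hn (coneEquation_mem_comap q) (tangentEquation_mem_comap q)) p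

theorem ringKrullDim_polynomialRing :
    ringKrullDim (MvPolynomial (Fin n ⊕ Fin n) ℂ) = ((2 * n : ℕ) : WithBot ℕ∞) := by
  rw [MvPolynomial.ringKrullDim_of_isNoetherianRing, ringKrullDim_eq_zero_of_field, zero_add]
  simp [two_mul]

/-- Some maximal ideal through the origin has the full height `2n`. -/
theorem exists_isPrime_height_eq :
    ∃ P : Ideal (MvPolynomial (Fin n ⊕ Fin n) ℂ), P.IsPrime ∧ (P.height : WithBot ℕ∞) = (2 * n : ℕ)
      ∧ ∀ p, aeval (0 : Fin n ⊕ Fin n → ℂ) p = 0 → p ∈ P := by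
  have : FiniteRingKrullDim (MvPolynomial (Fin n ⊕ Fin n) ℂ) := by
    rw [finiteRingKrullDim_iff_ne_bot_and_top, ringKrullDim_polynomialRing]
    exact ⟨WithBot.coe_ne_bot, fun h => ENat.natCast_ne_top _ (WithBot.coe_injective h)⟩
  obtain ⟨M, hM, hheight⟩ := Ideal.exists_isMaximal_height (R := MvPolynomial (Fin n ⊕ Fin n) ℂ)
  obtain ⟨c, rfl⟩ := isMaximal_iff_eq_vanishingIdeal_singleton.mp hM
  let e : MvPolynomial (Fin n ⊕ Fin n) ℂ ≃ₐ[ℂ] MvPolynomial (Fin n ⊕ Fin n) ℂ :=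
    AlgEquiv.ofAlgHom (aeval fun i => X i - C (c i)) (aeval fun i => X i + C (c i))
      (by ext i; simp) (by ext i; simp)
  refine ⟨(vanishingIdeal ℂ {c}).comap e.toRingEquiv, inferInstance, ?_, ?_⟩
  · rw [RingEquiv.height_comap, hheight, ringKrullDim_polynomialRing]
  · intro p hp
    rw [Ideal.mem_comap, mem_vanishingIdeal_singleton_iff]
    have : (aeval c).comp e.toAlgHom = aeval (0 : Fin n ⊕ Fin n → ℂ) := by
      ext i
      simp [e]
    rw [← hp, ← this]
    rfl

theorem ringKrullDim_eq (hn : 2 ≤ n) :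
    ringKrullDim (JetRing n) = ((2 * (n - 1) : ℕ) : WithBot ℕ∞) := by
  apply le_antisymm
  · rw [ringKrullDim_le_iff_height_le]
    intro p hp
    have h1 : ((p.height + 2 : ℕ∞) : WithBot ℕ∞) ≤ (2 * n : ℕ) :=
      (WithBot.coe_le_coe.mpr (height_add_two_le hn p)).trans
        ((Ideal.height_le_ringKrullDim_of_isPrime).trans ringKrullDim_polynomialRing.le)
    have h2 : p.height + 2 ≤ ((2 * (n - 1) : ℕ) : ℕ∞) + 2 := by
      have h3 : 2 * n = 2 * (n - 1) + 2 := by omega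
      rw [h3, Nat.cast_add] at h1
      exact WithBot.coe_le_coe.mp h1
    exact WithBot.coe_le_coe.mpr ((ENat.add_le_add_iff_right (by simp)).mp h2)
  · obtain ⟨P, hP, hheight, hmem⟩ := exists_isPrime_height_eq (n := n)
    have h := Ideal.height_le_ringKrullDim_quotient_add_encard (p := P)
      {coneEquation n, tangentEquation n} (by
        rintro x (rfl | rfl)
        · exact hmem _ (by simp [coneEquation])
        · exact hmem _ (by simp [tangentEquation]))
    have h2 : ((2 * n : ℕ) : WithBot ℕ∞) ≤ ringKrullDim (JetRing n) + (2 : ℕ) := by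
      rw [← hheight]
      refine h.trans ?_
      gcongr
      have : ({coneEquation n, tangentEquation n} : Set _).encard ≤ 2 :=
        (Set.encard_insert_le {tangentEquation n} _).trans (by simp [one_add_one_eq_two])
      exact WithBot.coe_le_coe.mpr this
    rw [show 2 * n = 2 * (n - 1) + 2 by omega, Nat.cast_add] at h2
    exact ENat.WithBot.add_le_add_natCast_right_iff.mp h2

theorem ker_localRingHom (p : Ideal (JetRing n)) [p.IsPrime] :
    RingHom.ker (Localization.localRingHom (p.comap (mk n)) p (mk n) rfl) =
      Ideal.span {algebraMap _ _ (coneEquation n), algebraMap _ _ (tangentEquation n)} := by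
  rw [Localization.ker_localRingHom_of_surjective mk_surjective, Ideal.mk_ker, Ideal.map_span,
    Set.image_pair]

theorem not_isRegularLocal_localization (hn : 2 ≤ n) (p : Ideal (JetRing n)) [p.IsPrime]
    (hp : ∀ i, mk n (X (Sum.inl i)) ∈ p) : ¬ IsRegularLocal (Localization.AtPrime p) := by
  refine not_isRegularLocal_of_ker_eq_span_pair
    (Localization.localRingHom_surjective_of_surjective mk_surjective p) (ker_localRingHom p)
    ?_ ?_ ?_
  · rw [← Localization.AtPrime.map_eq_maximalIdeal, ← Ideal.map_pow]
    exact Ideal.mem_map_of_mem _ (Ideal.sum_mem _ fun i _ =>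
      Ideal.pow_mem_pow (I := p.comap (mk n)) (hp i) 2)
  · rw [← Localization.AtPrime.map_eq_maximalIdeal]
    exact Ideal.mem_map_of_mem _ (tangentEquation_mem_comap p)
  · rw [IsLocalization.AtPrime.ringKrullDim_eq_height p,
      IsLocalization.AtPrime.ringKrullDim_eq_height (p.comap (mk n))]
    exact WithBot.coe_le_coe.mpr (height_add_two_le hn p)

/-- The Jacobian criterion for the two equations of the jet scheme. -/
theorem mem_and_mem_of_mul_mem_sq {P : Ideal (MvPolynomial (Fin n ⊕ Fin n) ℂ)} [P.IsPrime]
    (hf : coneEquation n ∈ P) (hg : tangentEquation n ∈ P) {j : Fin n} (hj : X (Sum.inl j) ∉ P)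
    {t a b : MvPolynomial (Fin n ⊕ Fin n) ℂ} (ht : t ∉ P)
    (h : t * (a * coneEquation n + b * tangentEquation n) ∈ P ^ 2) : a ∈ P ∧ b ∈ P := by
  have hP : P.IsPrime := inferInstance
  have hderiv (D : Derivation ℂ (MvPolynomial (Fin n ⊕ Fin n) ℂ) (MvPolynomial (Fin n ⊕ Fin n) ℂ)) :
      a * D (coneEquation n) + b * D (tangentEquation n) ∈ P := by
    have hsq : ∀ x ∈ P ^ 2, D x ∈ P := by
      intro x hx
      rw [pow_two] at hx
      refine Submodule.mul_induction_on hx (fun y hy z hz => ?_) (fun y z hy hz => ?_)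
      · rw [D.leibniz, smul_eq_mul, smul_eq_mul]
        exact P.add_mem (P.mul_mem_right _ hy) (P.mul_mem_right _ hz)
      · rw [map_add]
        exact P.add_mem hy hz
    refine (hP.mem_or_mem (x := t) ?_).resolve_left ht
    have key : t * (a * D (coneEquation n) + b * D (tangentEquation n)) =
        D (t * (a * coneEquation n + b * tangentEquation n)) -
          ((t * D a + D t * a) * coneEquation n + (t * D b + D t * b) * tangentEquation n) := by
      simp only [D.leibniz, map_add, smul_eq_mul]
      ring
    rw [key]
    exact P.sub_mem (hsq _ h) (P.add_mem (P.mul_mem_left _ hf) (P.mul_mem_left _ hg))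
  have hb : b ∈ P := by
    have := hderiv (pderiv (Sum.inr j))
    simp only [coneEquation, tangentEquation, map_sum, Derivation.leibniz, Derivation.leibniz_pow,
      pderiv_X, Pi.single_apply] at this
    simp at this
    exact (hP.mem_or_mem this).resolve_right hj
  refine ⟨?_, hb⟩
  have := hderiv (pderiv (Sum.inl j))
  rw [Ideal.add_mem_iff_left _ (P.mul_mem_right _ hb)] at this
  simp only [coneEquation, map_sum, Derivation.leibniz_pow,
      pderiv_X, Pi.single_apply] at this
  simp at this
  have h2 : IsUnit (2 : MvPolynomial (Fin n ⊕ Fin n) ℂ) := by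
    rw [← map_ofNat (C (σ := Fin n ⊕ Fin n) (R := ℂ))]
    exact (IsUnit.mk0 _ two_ne_zero).map _
  rw [mul_left_comm, Ideal.unit_mul_mem_iff_mem P h2] at this
  exact (hP.mem_or_mem this).resolve_right hj

theorem isRegularLocal_localization (p : Ideal (JetRing n)) [p.IsPrime] {j : Fin n}
    (hj : mk n (X (Sum.inl j)) ∉ p) : IsRegularLocal (Localization.AtPrime p) := by
  let P := p.comap (mk n)
  have hreg : IsRegularLocalRing (Localization.AtPrime p) := by
    refine IsRegularLocalRing.of_surjective_of_ker_eq_span_pair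
      (Localization.localRingHom_surjective_of_surjective mk_surjective p) (ker_localRingHom p)
      ?_ ?_ ?_
    · rw [← Localization.AtPrime.map_eq_maximalIdeal]
      exact Ideal.mem_map_of_mem _ (coneEquation_mem_comap p)
    · rw [← Localization.AtPrime.map_eq_maximalIdeal]
      exact Ideal.mem_map_of_mem _ (tangentEquation_mem_comap p)
    · intro a b hab
      obtain ⟨a', b', s, ha, hb⟩ := IsLocalization.surj₂ P.primeCompl _ a b
      have hs := IsLocalization.map_units (Localization.AtPrime P) s
      have hab' := Ideal.mul_mem_right
        (algebraMap _ (Localization.AtPrime P) (s : MvPolynomial (Fin n ⊕ Fin n) ℂ)) _ hab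
      rw [add_mul, mul_right_comm, mul_right_comm b, ha, hb, ← map_mul, ← map_mul, ← map_add,
        ← Localization.AtPrime.map_eq_maximalIdeal, ← Ideal.map_pow,
        IsLocalization.algebraMap_mem_map_algebraMap_iff P.primeCompl] at hab'
      obtain ⟨t, ht, h⟩ := hab'
      obtain ⟨ha', hb'⟩ := mem_and_mem_of_mul_mem_sq (coneEquation_mem_comap p)
        (tangentEquation_mem_comap p) hj ht h
      rw [← Ideal.mul_unit_mem_iff_mem _ hs, ha, ← Ideal.mul_unit_mem_iff_mem _ hs (x := b), hb,
        ← Localization.AtPrime.map_eq_maximalIdeal]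
      exact ⟨Ideal.mem_map_of_mem _ ha', Ideal.mem_map_of_mem _ hb'⟩
  exact IsRegularLocalRing.isRegularLocal

theorem singularLocus_eq (hn : 2 ≤ n) :
    {p : PrimeSpectrum (JetRing n) | ¬ IsRegularLocal (Localization.AtPrime p.asIdeal)} =
      PrimeSpectrum.zeroLocus (Set.range fun i => mk n (X (Sum.inl i))) := by
  ext p
  rw [Set.mem_ofPred_eq, PrimeSpectrum.mem_zeroLocus, Set.range_subset_iff]
  refine ⟨fun h i => ?_, not_isRegularLocal_localization hn p.asIdeal⟩
  by_contra hi
  exact h (isRegularLocal_localization p.asIdeal hi)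

/-- Restriction of functions to the fibre `{x₁ = ⋯ = xₙ = 0}` over the vertex of the cone. -/
noncomputable def restrictVertexFiber (n : ℕ) : JetRing n →+* MvPolynomial (Fin n) ℂ :=
  Ideal.Quotient.lift _ (aeval (Sum.elim 0 X) :
    MvPolynomial (Fin n ⊕ Fin n) ℂ →ₐ[ℂ] MvPolynomial (Fin n) ℂ).toRingHom (by
      intro a ha
      rw [← RingHom.mem_ker]
      refine Ideal.span_le.mpr ?_ ha
      rintro x (rfl | rfl)
      · simp [coneEquation]
      · simp [tangentEquation])

theorem restrictVertexFiber_mk (p : MvPolynomial (Fin n ⊕ Fin n) ℂ) :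
    restrictVertexFiber n (mk n p) = aeval (Sum.elim 0 X) p := rfl

theorem restrictVertexFiber_surjective : Function.Surjective (restrictVertexFiber n) := by
  intro p
  refine ⟨mk n (rename Sum.inr p), ?_⟩
  rw [restrictVertexFiber_mk, aeval_rename, Sum.elim_comp_inr, aeval_X_left_apply]

theorem ker_restrictVertexFiber :
    RingHom.ker (restrictVertexFiber n) =
      Ideal.span (Set.range fun i => mk n (X (Sum.inl i))) := by
  apply le_antisymm
  · intro y hy
    obtain ⟨p, rfl⟩ := mk_surjective y
    have key : (Ideal.Quotient.mk (Ideal.span (Set.range fun i => mk n (X (Sum.inl i))))).comp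
        (mk n) = ((Ideal.Quotient.mk _).comp (mk n)).comp
          ((rename Sum.inr).comp (aeval (Sum.elim 0 X) :
            MvPolynomial (Fin n ⊕ Fin n) ℂ →ₐ[ℂ] MvPolynomial (Fin n) ℂ)).toRingHom := by
      apply ringHom_ext
      · intro r
        simp
      · rintro (i | i)
        · simp
        · simp
    have hp : aeval (Sum.elim 0 X) p = (0 : MvPolynomial (Fin n) ℂ) := hy
    have h := RingHom.congr_fun key p
    simp only [RingHom.comp_apply, AlgHom.toRingHom_eq_coe, RingHom.coe_coe, AlgHom.comp_apply, hp,
      map_zero] at h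
    exact Ideal.Quotient.eq_zero_iff_mem.mp h
  · rw [Ideal.span_le]
    rintro _ ⟨i, rfl⟩
    simp [RingHom.mem_ker, restrictVertexFiber_mk]

theorem topologicalKrullDim_zeroLocus :
    topologicalKrullDim (PrimeSpectrum.zeroLocus (Set.range fun i => mk n (X (Sum.inl i)))) =
      ((n : ℕ) : WithBot ℕ∞) := by
  have hemb := PrimeSpectrum.isClosedEmbedding_comap_of_surjective _ (restrictVertexFiber n)
    restrictVertexFiber_surjective
  rw [← PrimeSpectrum.zeroLocus_span, ← ker_restrictVertexFiber,
    ← range_comap_of_surjective _ _ restrictVertexFiber_surjective,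
    ← IsHomeomorph.topologicalKrullDim_eq _ hemb.isEmbedding.toHomeomorph.isHomeomorph,
    PrimeSpectrum.topologicalKrullDim_eq_ringKrullDim,
    MvPolynomial.ringKrullDim_of_isNoetherianRing, ringKrullDim_eq_zero_of_field, zero_add]
  simp

section NotNormal

open Complex (I)

/-- The linear form `x₁ + i x₂`. -/
noncomputable def isotropicForm : MvPolynomial (Fin 3 ⊕ Fin 3) ℂ :=
  X (Sum.inl 0) + C I * X (Sum.inl 1)

/-- The restriction of polynomials to the hyperplane `x₁ + i x₂ = 0`. -/
noncomputable def restrictIsotropic :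
    MvPolynomial (Fin 3 ⊕ Fin 3) ℂ →ₐ[ℂ] MvPolynomial (Fin 3 ⊕ Fin 3) ℂ :=
  aeval (Function.update X (Sum.inl 0) (-(C I * X (Sum.inl 1))))

theorem C_I_sq : (C I : MvPolynomial (Fin 3 ⊕ Fin 3) ℂ) ^ 2 = -1 := by
  rw [← C_pow, Complex.I_sq, C_neg, C_1]

theorem isotropicForm_ne_zero : isotropicForm ≠ 0 := by
  intro h
  have := congrArg (eval (Sum.elim ![1, 0, 0] 0)) h
  simp [isotropicForm] at this

theorem isotropicForm_dvd_sub (p : MvPolynomial (Fin 3 ⊕ Fin 3) ℂ) :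
    isotropicForm ∣ p - restrictIsotropic p := by
  rw [← Ideal.mem_span_singleton, ← Ideal.Quotient.mk_eq_mk_iff_sub_mem]
  have key : (Ideal.Quotient.mk (Ideal.span {isotropicForm})) =
      (Ideal.Quotient.mk (Ideal.span {isotropicForm})).comp restrictIsotropic.toRingHom := by
    apply ringHom_ext
    · intro r
      simp
    · intro i
      obtain rfl | hi := eq_or_ne i (Sum.inl 0)
      · simp only [RingHom.comp_apply, AlgHom.toRingHom_eq_coe, RingHom.coe_coe]
        rw [Ideal.Quotient.mk_eq_mk_iff_sub_mem, Ideal.mem_span_singleton]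
        simp [restrictIsotropic, isotropicForm]
      · simp [restrictIsotropic, Function.update_of_ne hi]
  exact RingHom.congr_fun key p

theorem restrictIsotropic_isotropicForm : restrictIsotropic isotropicForm = 0 := by
  simp [restrictIsotropic, isotropicForm, ← algebraMap_eq]

theorem restrictIsotropic_coneEquation :
    restrictIsotropic (coneEquation 3) = X (Sum.inl 2) ^ 2 := by
  simp [restrictIsotropic, coneEquation, Fin.sum_univ_three, mul_pow, C_I_sq]

theorem not_dvd_restrictIsotropic_tangentEquation :
    ¬ X (Sum.inl 2) ∣ restrictIsotropic (tangentEquation 3) := by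
  intro h
  have := map_dvd (eval (Sum.elim ![0, 1, 0] ![0, 1, 0])) h
  simp [restrictIsotropic, tangentEquation, Fin.sum_univ_three] at this

theorem mk_isotropicForm_mem_nonZeroDivisors :
    mk 3 isotropicForm ∈ nonZeroDivisors (JetRing 3) := by
  rw [mem_nonZeroDivisors_iff_left]
  intro y hy
  obtain ⟨a, rfl⟩ := mk_surjective y
  rw [← map_mul, Ideal.Quotient.eq_zero_iff_mem, Ideal.mem_span_pair] at hy
  obtain ⟨α, β, h⟩ := hy
  obtain ⟨f₁, hf₁⟩ := isotropicForm_dvd_sub (coneEquation 3)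
  obtain ⟨g₁, hg₁⟩ := isotropicForm_dvd_sub (tangentEquation 3)
  obtain ⟨α₁, hα₁⟩ := isotropicForm_dvd_sub α
  obtain ⟨β₁, hβ₁⟩ := isotropicForm_dvd_sub β
  have hθ := congrArg restrictIsotropic h
  rw [map_add, map_mul, map_mul, map_mul, restrictIsotropic_isotropicForm, zero_mul,
    restrictIsotropic_coneEquation] at hθ
  rw [restrictIsotropic_coneEquation] at hf₁
  have hX : Prime (X (Sum.inl 2) : MvPolynomial (Fin 3 ⊕ Fin 3) ℂ) := X_prime
  obtain ⟨c, hc⟩ : X (Sum.inl 2) ^ 2 ∣ restrictIsotropic β :=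
    hX.pow_dvd_of_dvd_mul_right 2 not_dvd_restrictIsotropic_tangentEquation
      ⟨-restrictIsotropic α, by linear_combination hθ⟩
  have hα : restrictIsotropic α = -(c * restrictIsotropic (tangentEquation 3)) := by
    refine mul_left_cancel₀ (pow_ne_zero 2 hX.ne_zero) ?_
    linear_combination hθ - restrictIsotropic (tangentEquation 3) * hc
  rw [Ideal.Quotient.eq_zero_iff_mem, Ideal.mem_span_pair]
  refine ⟨c * g₁ + α₁, β₁ - f₁ * c, mul_left_cancel₀ isotropicForm_ne_zero ?_⟩
  linear_combination h - (coneEquation 3) * (hα₁ + hα) - (tangentEquation 3) * (hβ₁ + hc)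
    - c * coneEquation 3 * hg₁ + c * tangentEquation 3 * hf₁

/-- The Wronskian of `x₁ + i x₂` and `x₃`. Its quotient by `x₁ + i x₂` is a rational function on
the jet scheme that is integral but not regular. -/
noncomputable def wronskian : MvPolynomial (Fin 3 ⊕ Fin 3) ℂ :=
  isotropicForm * X (Sum.inr 2) - X (Sum.inl 2) * (X (Sum.inr 0) + C I * X (Sum.inr 1))

theorem mk_wronskian_sq :
    mk 3 wronskian ^ 2 = mk 3 isotropicForm ^ 2 * mk 3 (∑ i, X (Sum.inr i) ^ 2) := by
  have h : wronskian ^ 2 = isotropicForm ^ 2 * (∑ i, X (Sum.inr i) ^ 2) +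
      (X (Sum.inr 0) + C I * X (Sum.inr 1)) *
        ((X (Sum.inr 0) + C I * X (Sum.inr 1)) * coneEquation 3 -
          2 * isotropicForm * tangentEquation 3) := by
    simp only [wronskian, isotropicForm, coneEquation, tangentEquation, Fin.sum_univ_three]
    linear_combination -(X (Sum.inl 0) * X (Sum.inr 1) - X (Sum.inl 1) * X (Sum.inr 0)) ^ 2 * C_I_sq
  rw [← map_pow, h]
  simp only [map_add, map_sub, map_mul, map_pow, mk_coneEquation, mk_tangentEquation, mul_zero,
    sub_zero, add_zero]

theorem sq_ne_sum_X_sq (p : MvPolynomial (Fin 3) ℂ) : p ^ 2 ≠ ∑ i, X i ^ 2 := by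
  intro h
  have h1 := congrArg (aeval ![(Polynomial.X : Polynomial ℂ), 1, 0]) h
  rw [map_pow, Fin.sum_univ_three] at h1
  have h2 := congrArg (Polynomial.eval I) h1
  have h3 := congrArg (fun q => Polynomial.eval I (Polynomial.derivative q)) h1
  simp at h2
  simp [Polynomial.derivative_pow, h2] at h3

theorem not_isIntegrallyClosed : ¬ IsIntegrallyClosed (JetRing 3) := by
  intro h
  rw [isIntegrallyClosed_iff (FractionRing (JetRing 3))] at h
  let u : nonZeroDivisors (JetRing 3) := ⟨_, mk_isotropicForm_mem_nonZeroDivisors⟩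
  let δ := IsLocalization.mk' (FractionRing (JetRing 3)) (mk 3 wronskian) u
  have hδ : δ ^ 2 = algebraMap _ _ (mk 3 (∑ i, X (Sum.inr i) ^ 2)) := by
    rw [← IsLocalization.mk'_pow, IsLocalization.mk'_eq_iff_eq_mul, mk_wronskian_sq, map_mul,
      mul_comm]
    rfl
  have hint : IsIntegral (JetRing 3) δ := by
    refine IsIntegral.of_pow (n := 2) (by norm_num) ?_
    rw [hδ]
    exact isIntegral_algebraMap
  obtain ⟨y, hy⟩ := h hint
  have hy2 : y ^ 2 = mk 3 (∑ i, X (Sum.inr i) ^ 2) := by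
    apply IsFractionRing.injective (JetRing 3) (FractionRing (JetRing 3))
    rw [map_pow, hy, hδ]
  apply sq_ne_sum_X_sq (restrictVertexFiber 3 y)
  rw [← map_pow, hy2, restrictVertexFiber_mk]
  simp

end NotNormal

end JetRing

end FirstJetScheme

/-- Let `X ⊂ 𝔸ⁿ_ℂ` (`n ≥ 3`) be the quadric cone `x₁² + ⋯ + xₙ² = 0` and
`X₁ ⊂ 𝔸^{2n}` its first jet scheme, defined by `Σ xᵢ² = 0` and `Σ xᵢ xᵢ⁽¹⁾ = 0` (variables
`X (inl i) = xᵢ` and `X (inr i) = xᵢ⁽¹⁾`).  Then the singular locus of `X₁` (the set of primes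
at which the local ring is not regular) is the linear subspace `{x₁ = ⋯ = xₙ = 0} ≅ 𝔸ⁿ`, of
dimension `n`, while `dim X₁ = 2(n−1)`; in particular for `n = 3` the jet scheme `X₁` of the
normal surface `X` is not normal. -/
theorem stmt11 (n : ℕ) (hn : 3 ≤ n) :
    let S := MvPolynomial (Fin n ⊕ Fin n) ℂ
    let f : S := ∑ i : Fin n, MvPolynomial.X (Sum.inl i) ^ 2
    let g : S := ∑ i : Fin n, MvPolynomial.X (Sum.inl i) * MvPolynomial.X (Sum.inr i)
    let Q := S ⧸ (Ideal.span {f, g})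
    let xVars : Set Q :=
      Set.range fun i : Fin n => Ideal.Quotient.mk _ (MvPolynomial.X (Sum.inl i))
    ({ p : PrimeSpectrum Q | ¬ IsRegularLocal (Localization.AtPrime p.asIdeal) } =
        PrimeSpectrum.zeroLocus xVars) ∧
    topologicalKrullDim (PrimeSpectrum.zeroLocus xVars) = ((n : ℕ) : WithBot (WithTop ℕ)) ∧
    ringKrullDim Q = ((2 * (n - 1) : ℕ) : WithBot (WithTop ℕ)) ∧
    (n = 3 → ¬ IsIntegrallyClosed Q) := by
  intro S f g Q xVars
  refine ⟨JetRing.singularLocus_eq (by omega), JetRing.topologicalKrullDim_zeroLocus,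
    JetRing.ringKrullDim_eq (by omega), ?_⟩
  rintro rfl
  exact JetRing.not_isIntegrallyClosed
end
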